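/- Let X ⊂ ℝ^{n+1} be a polyhedral convex surface, i.e. a convex surface that can be covered by finitely many hyperplanes. Let (e,V) give a standard chart on X with associated convex function f, let t ∈ V and T := t + f(t)e ∈ X. Then there exists δ > 0 such that for all x, y ∈ V with t = (x+y)/2 and ‖x−t‖ = ‖y−t‖ < δ, every point S ∈ X satisfying dist_X(S, x+f(x)e) = dist_X(S, y+f(y)e) = dist_X(x+f(x)e, y+f(y)e)/2 (an intrinsic midpoint of x+f(x)e and y+f(y)e) fulfils dist_X(S,T) ≤ 2Δ²f(x,y). -/

import Mathlib

open Set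
open scoped NNReal RealInnerProductSpace

/-- A convex body: a compact convex set with nonempty interior. -/
def IsConvexBody {E : Type*} [NormedAddCommGroup E] [NormedSpace ℝ E] (C : Set E) : Prop :=
  IsCompact C ∧ Convex ℝ C ∧ (interior C).Nonempty

/-- A convex surface: the boundary of a convex body. -/
def IsConvexSurface {E : Type*} [NormedAddCommGroup E] [NormedSpace ℝ E] (X : Set E) : Prop :=
  ∃ C : Set E, IsConvexBody C ∧ X = frontier C

/-- The intrinsic distance on `X ⊆ E`: the infimum of lengths (total variations) of
continuous curves `γ : [0,1] → E` joining `a` and `b` within `X`. -/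
noncomputable def intrinsicDist {E : Type*} [NormedAddCommGroup E] [NormedSpace ℝ E]
    (X : Set E) (a b : E) : ℝ :=
  (⨅ γ : {γ : ℝ → E // ContinuousOn γ (Set.Icc 0 1) ∧ γ 0 = a ∧ γ 1 = b ∧
      Set.MapsTo γ (Set.Icc 0 1) X},
    eVariationOn γ.1 (Set.Icc 0 1)).toReal

/-- An `(e,V)`-standard chart on `X`, given by a unit vector `e`, a convex open subset `V`
of the hyperplane `e^⊥`, and a Lipschitz convex function `f : V → ℝ` whose graph
`{x + f(x)e : x ∈ V}` is a relatively open subset of `X`. -/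
def IsStandardChart {E : Type*} [NormedAddCommGroup E] [InnerProductSpace ℝ E]
    (X : Set E) (e : E) (V : Set ↥((Submodule.span ℝ {e})ᗮ))
    (f : ↥((Submodule.span ℝ {e})ᗮ) → ℝ) : Prop :=
  ‖e‖ = 1 ∧ IsOpen V ∧ Convex ℝ V ∧ ConvexOn ℝ V f ∧
    (∃ K : ℝ≥0, LipschitzOnWith K f V) ∧
    ∃ O : Set E, IsOpen O ∧
      (fun x : ↥((Submodule.span ℝ {e})ᗮ) => (x : E) + f x • e) '' V = X ∩ O

/-- A polyhedral convex surface: a convex surface covered by finitely many hyperplanes. -/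
def IsPolyhedralConvexSurface {E : Type*} [NormedAddCommGroup E] [InnerProductSpace ℝ E]
    (X : Set E) : Prop :=
  IsConvexSurface X ∧ ∃ (N : ℕ) (w : Fin N → E) (c : Fin N → ℝ),
    (∀ i, w i ≠ 0) ∧ X ⊆ ⋃ i, {x : E | ⟪w i, x⟫ = c i}

/-- The infimum of lengths defining `intrinsicDist`, before truncation to the reals. -/
noncomputable def intrinsicEDist {E : Type*} [NormedAddCommGroup E] [NormedSpace ℝ E]
    (X : Set E) (a b : E) : ENNReal :=
  ⨅ γ : {γ : ℝ → E // ContinuousOn γ (Set.Icc 0 1) ∧ γ 0 = a ∧ γ 1 = b ∧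
      Set.MapsTo γ (Set.Icc 0 1) X},
    eVariationOn γ.1 (Set.Icc 0 1)

section IntrinsicDist

variable {E : Type*} [NormedAddCommGroup E] [NormedSpace ℝ E] {X : Set E} {a b c : E}

theorem intrinsicDist_eq_toReal : intrinsicDist X a b = (intrinsicEDist X a b).toReal := rfl

theorem edist_le_intrinsicEDist : edist a b ≤ intrinsicEDist X a b := by
  refine le_iInf fun ⟨γ, _, h0, h1, _⟩ => ?_
  have h := eVariationOn.edist_le γ (s := Icc 0 1) (x := 0) (y := 1) (by simp) (by simp)
  rwa [h0, h1] at h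

theorem dist_le_intrinsicDist (h : intrinsicEDist X a b ≠ ⊤) :
    dist a b ≤ intrinsicDist X a b := by
  rw [intrinsicDist_eq_toReal, dist_edist]
  exact ENNReal.toReal_mono h edist_le_intrinsicEDist

theorem eVariationOn_lineMap_comp_le {g : ℝ → ℝ} {u v : ℝ} (huv : u ≤ v)
    (hg : MonotoneOn g (Icc u v)) (hu : g u = 0) (hv : g v = 1) :
    eVariationOn (fun s => AffineMap.lineMap a b (g s)) (Icc u v) ≤ edist a b := by
  have hL : LipschitzWith (nndist a b) (AffineMap.lineMap a b : ℝ → E) :=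
    lipschitzWith_lineMap a b
  refine ((hL.lipschitzOnWith (s := univ)).comp_eVariationOn_le
    (g := g) (s := Icc u v) (mapsTo_univ _ _)).trans ?_
  have h := hg.eVariationOn_eq (left_mem_Icc.2 huv) (right_mem_Icc.2 huv)
  rw [inter_self, hu, hv, sub_zero, ENNReal.ofReal_one] at h
  calc _ ≤ (nndist a b : ENNReal) * 1 := by gcongr; exact h.le
    _ = edist a b := by rw [mul_one, edist_nndist]

theorem intrinsicEDist_le_of_segment_subset (hac : segment ℝ a c ⊆ X)
    (hcb : segment ℝ c b ⊆ X) : intrinsicEDist X a b ≤ edist a c + edist c b := by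
  let γ : ℝ → E := fun s =>
    if s ≤ 1 / 2 then AffineMap.lineMap a c (2 * s) else AffineMap.lineMap c b (2 * s - 1)
  have hγ₁ : EqOn γ (fun s => AffineMap.lineMap a c (2 * s)) (Icc 0 (1 / 2)) :=
    fun s hs => if_pos hs.2
  have hγ₂ : EqOn γ (fun s => AffineMap.lineMap c b (2 * s - 1)) (Icc (1 / 2) 1) := by
    intro s hs
    rcases hs.1.eq_or_lt with rfl | h
    · simp [γ]
    · exact if_neg h.not_ge
  have hcont : Continuous γ := by
    refine Continuous.if_le ?_ ?_ continuous_id continuous_const ?_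
    · exact AffineMap.lineMap_continuous.comp (by fun_prop)
    · exact AffineMap.lineMap_continuous.comp (by fun_prop)
    · rintro s rfl
      simp
  have hmaps : MapsTo γ (Icc 0 1) X := by
    intro s hs
    rcases le_total s (1 / 2) with h | h
    · rw [hγ₁ ⟨hs.1, h⟩]
      refine hac ?_
      rw [segment_eq_image_lineMap]
      exact mem_image_of_mem _ ⟨by linarith [hs.1], by linarith⟩
    · rw [hγ₂ ⟨h, hs.2⟩]
      refine hcb ?_
      rw [segment_eq_image_lineMap]
      exact mem_image_of_mem _ ⟨by linarith, by linarith [hs.2]⟩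
  have h0 : γ 0 = a := by simp [γ]
  have h1 : γ 1 = b := by rw [hγ₂ (by norm_num)]; norm_num
  refine (iInf_le _ ⟨γ, hcont.continuousOn, h0, h1, hmaps⟩).trans ?_
  have hsplit := eVariationOn.Icc_add_Icc γ (s := univ) (a := 0) (b := 1 / 2) (c := 1)
    (by norm_num) (by norm_num) (mem_univ _)
  simp only [univ_inter] at hsplit
  rw [← hsplit, eVariationOn.congr hγ₁, eVariationOn.congr hγ₂]
  refine add_le_add
    (eVariationOn_lineMap_comp_le (by norm_num) ?_ (by norm_num) (by norm_num))
    (eVariationOn_lineMap_comp_le (by norm_num) ?_ (by norm_num) (by norm_num))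
  all_goals exact fun s _ r _ h => by simpa using h

theorem intrinsicEDist_ne_top_of_segment_subset (hac : segment ℝ a c ⊆ X)
    (hcb : segment ℝ c b ⊆ X) : intrinsicEDist X a b ≠ ⊤ :=
  ne_top_of_le_ne_top (ENNReal.add_ne_top.2 ⟨edist_ne_top _ _, edist_ne_top _ _⟩)
    (intrinsicEDist_le_of_segment_subset hac hcb)

theorem intrinsicDist_le_of_segment_subset (hac : segment ℝ a c ⊆ X)
    (hcb : segment ℝ c b ⊆ X) : intrinsicDist X a b ≤ dist a c + dist c b := by
  rw [intrinsicDist_eq_toReal, dist_edist, dist_edist,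
    ← ENNReal.toReal_add (edist_ne_top _ _) (edist_ne_top _ _)]
  exact ENNReal.toReal_mono (ENNReal.add_ne_top.2 ⟨edist_ne_top _ _, edist_ne_top _ _⟩)
    (intrinsicEDist_le_of_segment_subset hac hcb)

end IntrinsicDist

section InnerProduct

variable {E : Type*} [NormedAddCommGroup E] [InnerProductSpace ℝ E]

/-- A point whose distances to `a` and `b` are at most half the length of the broken line
`a, 0, b` is at distance at most `‖a + b‖` from the origin. -/
theorem norm_le_norm_add_of_norm_sub_le {a b s : E} {m : ℝ} (ha : ‖s - a‖ ≤ m)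
    (hb : ‖s - b‖ ≤ m) (hm : 2 * m ≤ ‖a‖ + ‖b‖) : ‖s‖ ≤ ‖a + b‖ := by
  have hm0 : 0 ≤ m := (norm_nonneg _).trans ha
  have h₁ := parallelogram_law_with_norm ℝ (s - a) (s - b)
  have h₂ := parallelogram_law_with_norm ℝ a b
  have e₁ : s - a + (s - b) = (2 : ℝ) • s - (a + b) := by module
  have e₂ : s - a - (s - b) = -(a - b) := by module
  rw [e₁, e₂, norm_neg] at h₁
  have hsq : ‖(2 : ℝ) • s - (a + b)‖ ^ 2 ≤ ‖a + b‖ ^ 2 := by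
    have ha2 : ‖s - a‖ ^ 2 ≤ m ^ 2 := by gcongr
    have hb2 : ‖s - b‖ ^ 2 ≤ m ^ 2 := by gcongr
    have hm2 : (2 * m) ^ 2 ≤ (‖a‖ + ‖b‖) ^ 2 := by gcongr
    nlinarith [sq_nonneg (‖a‖ - ‖b‖)]
  have hle : ‖(2 : ℝ) • s - (a + b)‖ ≤ ‖a + b‖ :=
    le_of_sq_le_sq hsq (norm_nonneg _)
  have htri : ‖(2 : ℝ) • s‖ ≤ ‖(2 : ℝ) • s - (a + b)‖ + ‖a + b‖ := by
    simpa using norm_add_le ((2 : ℝ) • s - (a + b)) (a + b)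
  rw [norm_smul, Real.norm_ofNat] at htri
  linarith

/-- Near a point `T` about which `X` is locally star-shaped, intrinsic midpoints of `A` and `B`
are at distance at most `‖(A - T) + (B - T)‖` from `T`. -/
theorem intrinsicDist_midpoint_le {X : Set E} {A B T S : E} {ε : ℝ}
    (hstar : ∀ P ∈ X, dist P T < ε → segment ℝ T P ⊆ X) (hTA : segment ℝ T A ⊆ X)
    (hTB : segment ℝ T B ⊆ X) (hne : A ≠ B) (hS : S ∈ X)
    (hSA : intrinsicDist X S A = intrinsicDist X A B / 2)
    (hSB : intrinsicDist X S B = intrinsicDist X A B / 2)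
    (hε : ‖A - T + (B - T)‖ < ε) : intrinsicDist X S T ≤ ‖A - T + (B - T)‖ := by
  have hAT : segment ℝ A T ⊆ X := (segment_symm ℝ A T).subset.trans hTA
  have hlow := dist_le_intrinsicDist (intrinsicEDist_ne_top_of_segment_subset hAT hTB)
  have hupp := intrinsicDist_le_of_segment_subset hAT hTB
  have hpos : 0 < intrinsicDist X A B := (dist_pos.2 hne).trans_le hlow
  have hfin : ∀ P, intrinsicDist X S P = intrinsicDist X A B / 2 →
      ‖S - T - (P - T)‖ ≤ intrinsicDist X A B / 2 := by
    intro P hP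
    rw [sub_sub_sub_cancel_right, ← dist_eq_norm, ← hP]
    refine dist_le_intrinsicDist fun h => ?_
    rw [intrinsicDist_eq_toReal, h, ENNReal.toReal_top] at hP
    linarith
  rw [dist_comm T B, dist_eq_norm, dist_eq_norm] at hupp
  have hST : ‖S - T‖ ≤ ‖A - T + (B - T)‖ :=
    norm_le_norm_add_of_norm_sub_le (hfin A hSA) (hfin B hSB) (by linarith)
  have hseg := hstar S hS (by rw [dist_eq_norm]; exact hST.trans_lt hε)
  have hle := intrinsicDist_le_of_segment_subset ((segment_symm ℝ S T).subset.trans hseg)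
    (c := T) (b := T) (by
      rw [segment_same]
      exact singleton_subset_iff.2 (hTA (left_mem_segment ℝ T A)))
  rw [dist_self, add_zero, dist_eq_norm] at hle
  exact hle.trans hST

theorem dense_setOf_inner_ne [CompleteSpace E] {w : E} (hw : w ≠ 0) (c : ℝ) :
    Dense {x : E | ⟪w, x⟫ ≠ c} := by
  have hsurj : Function.Surjective (innerSL ℝ w) := by
    intro r
    refine ⟨(r / ⟪w, w⟫) • w, ?_⟩
    rw [innerSL_apply_apply, inner_smul_right, div_mul_cancel₀ _ (inner_self_ne_zero.2 hw)]
  exact (dense_compl_singleton c).preimage ((innerSL ℝ w).isOpenMap hsurj)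

theorem exists_forall_inner_ne [CompleteSpace E] {ι : Type*} [Finite ι] {w : ι → E}
    (hw : ∀ i, w i ≠ 0) (c : ι → ℝ) {W : Set E} (hW : IsOpen W) (hne : W.Nonempty) :
    ∃ x ∈ W, ∀ i, ⟪w i, x⟫ ≠ c i := by
  have hd : Dense (⋂ i, {x : E | ⟪w i, x⟫ ≠ c i}) :=
    dense_iInter_of_isOpen (fun i => isOpen_ne_fun (by fun_prop) continuous_const)
      fun i => dense_setOf_inner_ne (hw i) (c i)
  obtain ⟨x, hxW, hx⟩ := hd.inter_open_nonempty W hW hne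
  exact ⟨x, hxW, mem_iInter.1 hx⟩

/-- A polyhedral convex surface is locally star-shaped about each of its points. -/
theorem IsPolyhedralConvexSurface.exists_segment_subset [CompleteSpace E] {X : Set E}
    (hX : IsPolyhedralConvexSurface X) {T : E} (hT : T ∈ X) :
    ∃ ε > 0, ∀ P ∈ X, dist P T < ε → segment ℝ T P ⊆ X := by
  obtain ⟨⟨C, ⟨hCcomp, hCconv, -⟩, rfl⟩, N, w, c, hw, hcov⟩ := hX
  have hCcl : IsClosed C := hCcomp.isClosed
  have hev : ∀ᶠ P in nhds T, ∀ i, ⟪w i, T⟫ ≠ c i → ⟪w i, P⟫ ≠ c i := by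
    refine Filter.eventually_all.2 fun i => ?_
    by_cases h : ⟪w i, T⟫ = c i
    · simp [h]
    · have : ContinuousAt (fun P : E => ⟪w i, P⟫) T := by fun_prop
      filter_upwards [this.eventually_ne h] with P hP _ using hP
  obtain ⟨ε, hε, hball⟩ := Metric.eventually_nhds_iff.1 hev
  refine ⟨ε, hε, fun P hP hPT Q hQ => ?_⟩
  by_contra hQX
  have hTC : T ∈ C := hCcl.frontier_subset hT
  have hPC : P ∈ C := hCcl.frontier_subset hP
  have hQint : Q ∈ interior C := by
    by_contra h
    exact hQX (hCcl.frontier_eq ▸ ⟨hCconv.segment_subset hTC hPC hQ, h⟩)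
  have hQT : dist Q T < ε :=
    (convex_ball T ε).segment_subset (Metric.mem_ball_self hε) hPT hQ
  obtain ⟨θ, ⟨hθ0, hθ1⟩, rfl⟩ : ∃ θ ∈ Icc (0 : ℝ) 1, T + θ • (P - T) = Q := by
    rw [segment_eq_image'] at hQ
    exact hQ
  have hθpos : 0 < θ := by
    rcases hθ0.eq_or_lt with rfl | h
    · simp [hT] at hQX
    · exact h
  -- `r > 1` places `T + r • (P - T)` beyond `P` but still close to `T`.
  obtain ⟨r, hr, hrε⟩ : ∃ r : ℝ, 1 < r ∧ dist (T + r • (P - T)) T < ε := by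
    have hc : ContinuousAt (fun r : ℝ => dist (T + r • (P - T)) T) 1 := by fun_prop
    have h1 : dist (T + (1 : ℝ) • (P - T)) T < ε := by simpa using hPT
    have hlt := (hc.eventually_lt_const h1).filter_mono (nhdsWithin_le_nhds (s := Ioi 1))
    obtain ⟨r, hr, hr1⟩ := (hlt.and self_mem_nhdsWithin).exists
    exact ⟨r, hr1, hr⟩
  have hR : T + r • (P - T) ∉ C := by
    intro hRC
    have hrθ : 0 < r - θ := by linarith
    have hPint := hCconv.combo_interior_self_mem_interior hQint hRC
      (a := (r - 1) / (r - θ)) (b := (1 - θ) / (r - θ)) (by apply div_pos <;> linarith)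
      (div_nonneg (by linarith) hrθ.le) (by field_simp; ring)
    have hPe : ((r - 1) / (r - θ)) • (T + θ • (P - T)) +
        ((1 - θ) / (r - θ)) • (T + r • (P - T)) = P := by
      match_scalars <;> field_simp <;> ring
    rw [hPe] at hPint
    exact (hCcl.frontier_eq ▸ hP).2 hPint
  let g : E → E := fun q => T + (r / θ) • (q - T)
  have hg : Continuous g := by fun_prop
  have hgQ : g (T + θ • (P - T)) = T + r • (P - T) := by
    simp only [g, add_sub_cancel_left, smul_smul, div_mul_cancel₀ r hθpos.ne']
  obtain ⟨q, ⟨⟨hqC, hqε⟩, hgq⟩, hq⟩ := exists_forall_inner_ne hw c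
    (W := (interior C ∩ Metric.ball T ε) ∩ g ⁻¹' (Cᶜ ∩ Metric.ball T ε))
    ((isOpen_interior.inter Metric.isOpen_ball).inter
      ((hCcl.isOpen_compl.inter Metric.isOpen_ball).preimage hg))
    ⟨_, ⟨hQint, hQT⟩, by rw [mem_preimage, hgQ]; exact ⟨hR, hrε⟩⟩
  obtain ⟨Z, hZseg, hZ⟩ : (segment ℝ q (g q) ∩ frontier C).Nonempty := by
    by_contra hempty
    obtain ⟨Z, -, hZint, hZC⟩ := (convex_segment (𝕜 := ℝ) q (g q)).isPreconnected
      (interior C) Cᶜ isOpen_interior hCcl.isOpen_compl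
      (fun Z hZ => by
        by_contra h
        rw [mem_union, not_or, notMem_compl_iff] at h
        exact hempty ⟨Z, hZ, hCcl.frontier_eq ▸ ⟨h.2, h.1⟩⟩)
      ⟨q, left_mem_segment ℝ _ _, hqC⟩ ⟨g q, right_mem_segment ℝ _ _, hgq.1⟩
    exact hZC (interior_subset hZint)
  obtain ⟨i, hi⟩ := mem_iUnion.1 (hcov hZ)
  have hZT : dist Z T < ε := (convex_ball T ε).segment_subset hqε hgq.2 hZseg
  have hTi : ⟪w i, T⟫ = c i := by
    by_contra h
    exact hball hZT i h hi
  rw [segment_eq_image'] at hZseg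
  obtain ⟨μ, ⟨hμ0, hμ1⟩, rfl⟩ := hZseg
  have hratio : 1 < r / θ := by rw [lt_div_iff₀ hθpos]; linarith
  have hlam : 0 < 1 + μ * (r / θ - 1) := by nlinarith
  have hexp : q + μ • (g q - q) = T + (1 + μ * (r / θ - 1)) • (q - T) := by
    simp only [g]
    module
  simp only [mem_ofPred_eq] at hi
  rw [hexp, inner_add_right, inner_smul_right, hTi, add_eq_left, mul_eq_zero,
    inner_sub_right, hTi, sub_eq_zero] at hi
  exact hq i (hi.resolve_left hlam.ne')

end InnerProduct

/-- Let `X ⊂ ℝ^{n+1}` be a polyhedral convex surface with an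
`(e,V)`-standard chart with associated convex function `f`, let `t ∈ V` and
`T := t + f(t)e`. Then there is `δ > 0` such that for all `x, y ∈ V` with `t = (x+y)/2`
and `‖x−t‖ = ‖y−t‖ < δ`, every intrinsic midpoint `S` of `x+f(x)e` and `y+f(y)e`
satisfies `dist_X(S,T) ≤ 2·Δ²f(x,y) = 2·((f(x)+f(y))/2 − f(t))`. -/
theorem midpoint_estimate_polyhedral (n : ℕ)
    (X : Set (EuclideanSpace ℝ (Fin (n + 1)))) (hX : IsPolyhedralConvexSurface X)
    (e : EuclideanSpace ℝ (Fin (n + 1)))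
    (V : Set ↥((Submodule.span ℝ {e})ᗮ)) (f : ↥((Submodule.span ℝ {e})ᗮ) → ℝ)
    (hchart : IsStandardChart X e V f)
    (t : ↥((Submodule.span ℝ {e})ᗮ)) (ht : t ∈ V) :
    ∃ δ > (0:ℝ), ∀ x ∈ V, ∀ y ∈ V, t = midpoint ℝ x y →
      ‖x - t‖ = ‖y - t‖ → ‖x - t‖ < δ →
      ∀ S ∈ X,
        intrinsicDist X S ((x : EuclideanSpace ℝ (Fin (n + 1))) + f x • e) =
          intrinsicDist X ((x : EuclideanSpace ℝ (Fin (n + 1))) + f x • e)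
            ((y : EuclideanSpace ℝ (Fin (n + 1))) + f y • e) / 2 →
        intrinsicDist X S ((y : EuclideanSpace ℝ (Fin (n + 1))) + f y • e) =
          intrinsicDist X ((x : EuclideanSpace ℝ (Fin (n + 1))) + f x • e)
            ((y : EuclideanSpace ℝ (Fin (n + 1))) + f y • e) / 2 →
        intrinsicDist X S ((t : EuclideanSpace ℝ (Fin (n + 1))) + f t • e) ≤
          2 * ((f x + f y) / 2 - f t) := by
  obtain ⟨he, -, -, hconv, ⟨K, hK⟩, O, -, hO⟩ := hchart
  have hgraph : ∀ z ∈ V, (z : EuclideanSpace ℝ (Fin (n + 1))) + f z • e ∈ X := fun z hz =>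
    (hO.subset (mem_image_of_mem _ hz)).1
  obtain ⟨ε, hε, hstar⟩ := hX.exists_segment_subset (hgraph t ht)
  refine ⟨ε / (2 * (1 + K)), by positivity, fun x hx y hy hmid hxy hxδ S hS hSx hSy => ?_⟩
  rw [lt_div_iff₀ (by positivity)] at hxδ
  have hsub : ∀ z : ↥((Submodule.span ℝ {e})ᗮ),
      (z : EuclideanSpace ℝ (Fin (n + 1))) + f z • e - (t + f t • e) =
        ((z - t : ↥((Submodule.span ℝ {e})ᗮ)) : EuclideanSpace ℝ (Fin (n + 1))) +
          (f z - f t) • e := by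
    intro z
    rw [Submodule.coe_sub]
    module
  have hlip : ∀ z ∈ V, |f z - f t| ≤ K * ‖z - t‖ := fun z hz => by
    simpa [dist_eq_norm] using hK.dist_le_mul z hz t ht
  have hclose : ∀ z ∈ V, ‖z - t‖ = ‖x - t‖ →
      dist ((z : EuclideanSpace ℝ (Fin (n + 1))) + f z • e) (t + f t • e) < ε := by
    intro z hz hzx
    rw [dist_eq_norm, hsub]
    refine (norm_add_le _ _).trans_lt ?_
    rw [norm_smul, he, mul_one, Real.norm_eq_abs, ← Submodule.coe_norm, hzx]
    have h₁ := hlip z hz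
    rw [hzx] at h₁
    nlinarith [norm_nonneg (x - t), K.coe_nonneg]
  have hsegx := hstar _ (hgraph x hx) (hclose x hx rfl)
  have hsegy := hstar _ (hgraph y hy) (hclose y hy hxy.symm)
  have hsum : (x - t) + (y - t) = 0 := by
    rw [hmid, sub_add_sub_comm, midpoint_add_self, sub_self]
  have hκ : 0 ≤ f x + f y - 2 * f t := by
    have h₁ : f ((1 / 2 : ℝ) • x + (1 / 2 : ℝ) • y) ≤ (1 / 2 : ℝ) • f x + (1 / 2 : ℝ) • f y :=
      hconv.2 hx hy (by norm_num) (by norm_num) (by norm_num)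
    have h₂ : (1 / 2 : ℝ) • x + (1 / 2 : ℝ) • y = t := by
      rw [hmid, midpoint_eq_smul_add, smul_add, invOf_eq_inv, one_div]
    rw [h₂, smul_eq_mul, smul_eq_mul] at h₁
    linarith
  rcases eq_or_ne x y with rfl | hne
  · rw [midpoint_self] at hmid
    subst hmid
    have h0 := intrinsicDist_le_of_segment_subset
      (hsegx.trans' (segment_symm ℝ _ _).le) hsegx
    rw [dist_self, add_zero] at h0
    linarith
  have hxyz : (x : EuclideanSpace ℝ (Fin (n + 1))) + f x • e - (t + f t • e) +
      (y + f y • e - (t + f t • e)) = (f x + f y - 2 * f t) • e := by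
    rw [hsub, hsub, add_add_add_comm, ← Submodule.coe_add, hsum, Submodule.coe_zero, zero_add]
    module
  have hnorm : ‖(x : EuclideanSpace ℝ (Fin (n + 1))) + f x • e - (t + f t • e) +
      (y + f y • e - (t + f t • e))‖ = f x + f y - 2 * f t := by
    rw [hxyz, norm_smul, he, mul_one, Real.norm_of_nonneg hκ]
  have hκε : f x + f y - 2 * f t < ε := by
    have h₁ := le_abs_self (f x - f t)
    have h₂ := le_abs_self (f y - f t)
    have h₃ := hlip x hx
    have h₄ := hlip y hy
    rw [← hxy] at h₄
    nlinarith [norm_nonneg (x - t), K.coe_nonneg]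
  have hAB : (x : EuclideanSpace ℝ (Fin (n + 1))) + f x • e ≠ y + f y • e := by
    intro h
    have hxy' : ((x - y : ↥((Submodule.span ℝ {e})ᗮ)) : EuclideanSpace ℝ (Fin (n + 1))) =
        (f y - f x) • e := by
      rw [Submodule.coe_sub, sub_smul, sub_eq_sub_iff_add_eq_add, h]
      exact add_comm _ _
    have hmem : ((x - y : ↥((Submodule.span ℝ {e})ᗮ)) : EuclideanSpace ℝ (Fin (n + 1))) ∈
        Submodule.span ℝ {e} := by
      rw [hxy']
      exact Submodule.smul_mem _ _ (Submodule.mem_span_singleton_self e)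
    have h0 := Submodule.inner_right_of_mem_orthogonal hmem (x - y).2
    rw [inner_self_eq_zero, Submodule.coe_eq_zero, sub_eq_zero] at h0
    exact hne h0
  have hfin := intrinsicDist_midpoint_le hstar hsegx hsegy hAB hS hSx hSy (hnorm ▸ hκε)
  rw [hnorm] at hfin
  linarith
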